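/- Let f ∈ 𝓒 and θ ∈ ℝ. Then lim_{n→∞} (Z_n(f,θ) − log n!)/n exists and equals Z(f,θ) := sup_{μ ∈ 𝓜} { θ μ[f] − D(μ||u) }. -/

import Mathlib

open MeasureTheory Filter Topology
open scoped ENNReal

noncomputable section

/-- The unit square `[0,1]²` in `ℝ × ℝ`. -/
def unitSq : Set (ℝ × ℝ) := Set.Icc 0 1 ×ˢ Set.Icc 0 1

/-- Lebesgue measure restricted to `[0,1]`. -/
def unif01 : Measure ℝ := volume.restrict (Set.Icc 0 1)

/-- Lebesgue (uniform) measure on the unit square. -/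
def usq : Measure (ℝ × ℝ) := unif01.prod unif01

/-- `𝓜`: Borel probability measures on `[0,1]²` with both marginals Lebesgue on `[0,1]`. -/
def MM : Set (Measure (ℝ × ℝ)) :=
  {μ | IsProbabilityMeasure μ ∧ μ.map Prod.fst = unif01 ∧ μ.map Prod.snd = unif01}

/-- The class `𝓒` of continuous functions on the unit square, not identically zero,
with all row and column integrals vanishing. -/
def memC (f : ℝ × ℝ → ℝ) : Prop :=
  ContinuousOn f unitSq ∧ (∃ p ∈ unitSq, f p ≠ 0) ∧
    (∀ x ∈ Set.Icc (0 : ℝ) 1, (∫ z in (0 : ℝ)..1, f (x, z)) = 0) ∧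
    (∀ y ∈ Set.Icc (0 : ℝ) 1, (∫ z in (0 : ℝ)..1, f (z, y)) = 0)

open scoped Classical in
/-- Kullback–Leibler divergence `D(μ‖ν)`, equal to `∫ log(dμ/dν) dμ` when `μ ≪ ν`
(and this integral exists), and `+∞` otherwise. -/
def KL (μ ν : Measure (ℝ × ℝ)) : ℝ≥0∞ :=
  if μ ≪ ν ∧ Integrable (fun x => Real.log ((μ.rnDeriv ν x).toReal)) μ then
    ENNReal.ofReal (∫ x, Real.log ((μ.rnDeriv ν x).toReal) ∂μ)
  else ⊤

/-- The objective `θ μ[f] − D(μ‖u)`, as an extended real. -/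
def objE (f : ℝ × ℝ → ℝ) (θ : ℝ) (μ : Measure (ℝ × ℝ)) : EReal :=
  ((θ * ∫ p, f p ∂μ : ℝ) : EReal) - (KL μ usq : EReal)

/-- `∑_{i=1}^n f(i/n, π(i)/n)`. -/
def permStat (f : ℝ × ℝ → ℝ) (n : ℕ) (π : Equiv.Perm (Fin n)) : ℝ :=
  ∑ i : Fin n, f ((i.1 + 1 : ℝ) / n, ((π i).1 + 1 : ℝ) / n)

/-- The log normalizing constant `Z_n(f,θ)`. -/
def Zn (f : ℝ × ℝ → ℝ) (θ : ℝ) (n : ℕ) : ℝ :=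
  Real.log (∑ π : Equiv.Perm (Fin n), Real.exp (θ * permStat f n π))

open scoped Classical in
/-- The probability that a sample from `Q_{n,f,θ}` satisfies `p`. -/
def Qprob (f : ℝ × ℝ → ℝ) (θ : ℝ) (n : ℕ) (p : Equiv.Perm (Fin n) → Prop) : ℝ :=
  ∑ π : Equiv.Perm (Fin n), if p π then Real.exp (θ * permStat f n π - Zn f θ n) else 0

section Counting

variable {ι κ : Type*} [Fintype ι] [DecidableEq ι] [Fintype κ] [DecidableEq κ]

/-- Summing over permutations a function of the colour pattern `c ∘ π` overcounts each pattern at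
most `∏ a, |c⁻¹(a)|!` times. -/
lemma sum_perm_comp_le (c : ι → κ) (F : (ι → κ) → ℝ) (hF : ∀ s, 0 ≤ F s) :
    ∑ π : Equiv.Perm ι, F (c ∘ π) ≤
      (∏ a, (Fintype.card {i // c i = a}).factorial : ℕ) * ∑ s, F s := by
  classical
  rw [← Finset.sum_fiberwise Finset.univ (fun π : Equiv.Perm ι => c ∘ π), Finset.mul_sum]
  refine Finset.sum_le_sum fun s _ => ?_
  rw [Finset.sum_congr rfl (g := fun _ => F s) (by simp +contextual), Finset.sum_const,
    nsmul_eq_mul]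
  refine mul_le_mul_of_nonneg_right ?_ (hF s)
  rw [← DomMulAct.stabilizer_card c, ← Finset.card_univ]
  norm_cast
  rcases (Finset.univ.filter fun π : Equiv.Perm ι => c ∘ π = s).eq_empty_or_nonempty with h | ⟨σ, hσ⟩
  · simp [h]
  · have hσ' : c ∘ σ = s := by simpa using hσ
    refine Finset.card_le_card_of_injOn
      (fun π => if h : c ∘ π = s then ⟨π * σ⁻¹, by
        ext i
        have := congrFun (h.trans hσ'.symm) (σ⁻¹ i)
        simpa using this⟩ else ⟨1, rfl⟩) (by simp) ?_
    intro π hπ π' hπ' h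
    have h1 : c ∘ π = s := by simpa using hπ
    have h2 : c ∘ π' = s := by simpa using hπ'
    simpa [h1, h2] using h

/-- For a row-stochastic nonnegative matrix, the colour-block permanent is at most the number of
colour-preserving permutations. -/
lemma sum_perm_prod_le (c : ι → κ) (p : κ → κ → ℝ) (hp : ∀ a b, 0 ≤ p a b)
    (hrow : ∀ a, ∑ b, p a b = 1) :
    ∑ π : Equiv.Perm ι, ∏ i, p (c i) (c (π i)) ≤
      (∏ a, (Fintype.card {i // c i = a}).factorial : ℕ) := by
  have h := sum_perm_comp_le c (fun s => ∏ i, p (c i) (s i))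
    (fun s => Finset.prod_nonneg fun i _ => hp _ _)
  have h2 : ∑ s : ι → κ, ∏ i, p (c i) (s i) = 1 := by
    have := (Finset.prod_univ_sum (fun _ : ι => (Finset.univ : Finset κ))
      (fun i b => p (c i) b)).symm
    rw [Fintype.piFinset_univ] at this
    rw [this]
    exact Finset.prod_eq_one fun i _ => hrow _
  rw [h2, mul_one] at h
  exact h

/-- The double-coset of a permutation under colour-preserving permutations is large. -/
lemma card_mul_le_sum_perm (c : ι → κ) (w : Equiv.Perm ι → ℝ) (hw : ∀ π, 0 ≤ w π)
    (π₀ : Equiv.Perm ι)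
    (hinv : ∀ α β : Equiv.Perm ι, c ∘ α = c → c ∘ β = c → w (β * π₀ * α) = w π₀) :
    ((∏ a, (Fintype.card {i // c i = a}).factorial : ℕ) : ℝ) ^ 2 * w π₀ ≤
      (∏ q : κ × κ, (Fintype.card {i // (c i, c (π₀ i)) = q}).factorial : ℕ) *
        ∑ π, w π := by
  classical
  let G := {g : Equiv.Perm ι // c ∘ g = c}
  let Φ : G × G → Equiv.Perm ι := fun x => x.2.1 * π₀ * x.1.1
  have hG : Fintype.card G = ∏ a, (Fintype.card {i // c i = a}).factorial :=
    DomMulAct.stabilizer_card c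
  have h1 : ∑ x : G × G, w (Φ x) = (Fintype.card G : ℝ) ^ 2 * w π₀ := by
    rw [Finset.sum_congr rfl (g := fun _ => w π₀) fun x _ => hinv _ _ x.1.2 x.2.2,
      Finset.sum_const, nsmul_eq_mul, Finset.card_univ, Fintype.card_prod]
    push_cast
    ring
  rw [← hG, ← h1, ← Finset.sum_fiberwise Finset.univ Φ, Finset.mul_sum]
  refine Finset.sum_le_sum fun π _ => ?_
  rw [Finset.sum_congr rfl (g := fun _ => w π) (by simp +contextual), Finset.sum_const,
    nsmul_eq_mul]
  refine mul_le_mul_of_nonneg_right ?_ (hw π)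
  rw [← DomMulAct.stabilizer_card fun i => (c i, c (π₀ i)), ← Finset.card_univ]
  norm_cast
  rcases (Finset.univ.filter fun x : G × G => Φ x = π).eq_empty_or_nonempty with h | ⟨y, hy⟩
  · simp [h]
  · have hy' : y.2.1 * π₀ * y.1.1 = π := by simpa using hy
    have key : ∀ x : G × G, Φ x = π →
        (fun i => (c i, c (π₀ i))) ∘ (x.1.1 * y.1.1⁻¹ : Equiv.Perm ι) =
          fun i => (c i, c (π₀ i)) := by
      intro x hx
      ext i
      · have e1 := congrFun x.1.2 (y.1.1.symm i)
        have e2 := congrFun y.1.2 (y.1.1.symm i)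
        simp only [Function.comp_apply, Equiv.apply_symm_apply] at e1 e2
        simp [e1, e2]
      · have e0 : x.2.1 (π₀ (x.1.1 (y.1.1⁻¹ i))) = y.2.1 (π₀ i) := by
          have := DFunLike.congr_fun (hx.trans hy'.symm) (y.1.1⁻¹ i)
          simpa [Φ] using this
        have e1 := congrFun x.2.2 (π₀ (x.1.1 (y.1.1⁻¹ i)))
        have e2 := congrFun y.2.2 (π₀ i)
        simp only [Function.comp_apply] at e1 e2
        simp only [Function.comp_apply, Equiv.Perm.mul_apply]
        rw [← e1, e0, e2]
    refine Finset.card_le_card_of_injOn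
      (fun x => if h : Φ x = π then ⟨x.1.1 * y.1.1⁻¹, key x h⟩ else ⟨1, rfl⟩) (by simp) ?_
    intro x hx x' hx' h
    have h1 : Φ x = π := by simpa using hx
    have h2 : Φ x' = π := by simpa using hx'
    have e1 : x.1 = x'.1 := by
      have : (x.1.1 : Equiv.Perm ι) = x'.1.1 := by simpa [h1, h2] using h
      exact Subtype.ext this
    have e2 : x.2.1 * π₀ * x.1.1 = x'.2.1 * π₀ * x'.1.1 := h1.trans h2.symm
    rw [e1] at e2
    exact Prod.ext e1 (Subtype.ext (mul_right_cancel (mul_right_cancel e2)))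

omit [DecidableEq ι] in
/-- A contingency table whose margins are the colour counts is realised by a permutation. -/
lemma exists_perm_table (c : ι → κ) (N : κ → κ → ℕ)
    (hrow : ∀ a, ∑ b, N a b = Fintype.card {i // c i = a})
    (hcol : ∀ b, ∑ a, N a b = Fintype.card {i // c i = b}) :
    ∃ π : Equiv.Perm ι, ∀ q : κ × κ, Fintype.card {i // (c i, c (π i)) = q} = N q.1 q.2 := by
  classical
  let T := Σ q : κ × κ, Fin (N q.1 q.2)
  have E : ∀ φ : T → κ, (∀ a, Fintype.card {t // φ t = a} = Fintype.card {i // c i = a}) →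
      ∃ e : ι ≃ T, ∀ i, φ (e i) = c i := by
    intro φ h
    let e : ι ≃ T := (Equiv.sigmaFiberEquiv c).symm.trans
      ((Equiv.sigmaCongrRight fun a => (Fintype.equivOfCardEq (h a)).symm).trans
        (Equiv.sigmaFiberEquiv φ))
    refine ⟨e, fun i => ?_⟩
    exact (Fintype.equivOfCardEq (h (c i))).symm ⟨i, rfl⟩ |>.2
  have hT : ∀ P : κ × κ → Prop, ∀ [DecidablePred P], Fintype.card {t : T // P t.1} =
      ∑ q with P q, N q.1 q.2 := by
    intro P _
    rw [Fintype.card_subtype, Finset.card_filter, ← Finset.univ_sigma_univ, Finset.sum_sigma,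
      Finset.sum_filter]
    refine Finset.sum_congr rfl fun q _ => ?_
    by_cases hq : P q <;> simp [hq]
  obtain ⟨e1, h1⟩ := E (fun t => t.1.1) fun a => by
    rw [hT (fun q => q.1 = a), ← hrow a, Finset.sum_filter, Fintype.sum_prod_type,
      Finset.sum_eq_single a] <;> simp +contextual
  obtain ⟨e2, h2⟩ := E (fun t => t.1.2) fun b => by
    rw [hT (fun q => q.2 = b), ← hcol b, Finset.sum_filter, Fintype.sum_prod_type]
    simp
  refine ⟨e1.trans e2.symm, fun q => ?_⟩
  have : ∀ i, (c i, c ((e1.trans e2.symm) i)) = (e1 i).1 := fun i => by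
    rw [← h1 i, ← h2]; simp
  simp_rw [this]
  rw [Fintype.card_congr (Equiv.subtypeEquiv e1 (q := fun t : T => t.1 = q) fun i => Iff.rfl),
    hT (fun q' => q' = q)]
  simp [Finset.filter_eq']

/-- Lower bound on a colour-block permanent by a single contingency table. -/
lemma table_le_sum_perm_prod (c : ι → κ) (p : κ → κ → ℝ) (hp : ∀ a b, 0 ≤ p a b)
    (N : κ → κ → ℕ)
    (hrow : ∀ a, ∑ b, N a b = Fintype.card {i // c i = a})
    (hcol : ∀ b, ∑ a, N a b = Fintype.card {i // c i = b}) :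
    ((∏ a, (Fintype.card {i // c i = a}).factorial : ℕ) : ℝ) ^ 2 *
        ∏ q : κ × κ, p q.1 q.2 ^ N q.1 q.2 ≤
      (∏ q : κ × κ, (N q.1 q.2).factorial : ℕ) *
        ∑ π : Equiv.Perm ι, ∏ i, p (c i) (c (π i)) := by
  obtain ⟨π₀, h₀⟩ := exists_perm_table c N hrow hcol
  have h := card_mul_le_sum_perm c (fun π => ∏ i, p (c i) (c (π i)))
    (fun π => Finset.prod_nonneg fun i _ => hp _ _) π₀ (by
      intro α β hα hβ
      refine Fintype.prod_equiv α _ _ fun i => ?_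
      have e1 := congrFun hα i
      have e2 := congrFun hβ (π₀ (α i))
      simp only [Function.comp_apply] at e1 e2
      simp [e1, e2])
  simp_rw [h₀] at h
  have e : ∏ i, p (c i) (c (π₀ i)) = ∏ q : κ × κ, p q.1 q.2 ^ N q.1 q.2 := by
    rw [← Finset.prod_fiberwise Finset.univ (fun i => (c i, c (π₀ i)))]
    refine Finset.prod_congr rfl fun q _ => ?_
    rw [← h₀ q, Fintype.card_subtype, ← Finset.prod_const]
    refine Finset.prod_congr rfl fun i hi => ?_
    have : (c i, c (π₀ i)) = q := by simpa using hi
    rw [← this]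
  rw [← e]
  exact h

end Counting

section Asymptotics

lemma log_factorial_sub_nonneg (N : ℕ) :
    0 ≤ Real.log N.factorial - N * Real.log N + N := by
  rcases Nat.eq_zero_or_pos N with rfl | hN
  · simp
  have hN' : (0 : ℝ) < N := by exact_mod_cast hN
  have h := Real.pow_div_factorial_le_exp (x := N) hN'.le N
  have h2 := Real.log_le_log (by positivity) h
  rw [Real.log_div (by positivity) (by positivity), Real.log_pow, Real.log_exp] at h2
  linarith

lemma log_factorial_sub_le (N : ℕ) :
    Real.log N.factorial - N * Real.log N + N ≤ 1 + Real.log N := by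
  rcases Nat.eq_zero_or_pos N with rfl | hN
  · simp
  induction N, hN using Nat.le_induction with
  | base => simp
  | succ N hN ih =>
    have hN' : (0 : ℝ) < N := by exact_mod_cast hN
    have h := Real.one_sub_inv_le_log_of_pos (x := (N + 1 : ℝ) / N) (by positivity)
    rw [Real.log_div (by positivity) (by positivity)] at h
    have h3 : 1 ≤ (N + 1 : ℝ) * (Real.log (N + 1) - Real.log N) := by
      calc (1 : ℝ) = (N + 1) * (1 - ((N + 1 : ℝ) / N)⁻¹) := by field_simp; ring
        _ ≤ _ := mul_le_mul_of_nonneg_left h (by positivity)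
    rw [Nat.factorial_succ]
    push_cast
    rw [Real.log_mul (by positivity) (by positivity)]
    linarith

/-- If `N n / n → q` then `log (N n)! = N n log n - N n + n (q log q + o(1))`. -/
lemma tendsto_log_factorial (N : ℕ → ℕ) (hN : ∀ n, N n ≤ n) {q : ℝ}
    (hq : Tendsto (fun n : ℕ => (N n : ℝ) / n) atTop (𝓝 q)) :
    Tendsto (fun n : ℕ => (Real.log (N n).factorial - N n * Real.log n + N n) / n) atTop
      (𝓝 (q * Real.log q)) := by
  have h1 : Tendsto (fun n : ℕ => (Real.log (N n).factorial - N n * Real.log (N n) + N n) / n)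
      atTop (𝓝 0) := by
    have h0 : Tendsto (fun n : ℕ => (1 : ℝ) / n + Real.log n / n) atTop (𝓝 (0 + 0)) := by
      refine tendsto_one_div_atTop_nhds_zero_nat.add ?_
      have := Real.isLittleO_log_id_atTop.tendsto_div_nhds_zero
      exact this.comp tendsto_natCast_atTop_atTop
    rw [add_zero] at h0
    refine squeeze_zero (fun n => div_nonneg (log_factorial_sub_nonneg _) (by positivity))
      (fun n => ?_) h0
    rw [← add_div]
    refine div_le_div_of_nonneg_right ((log_factorial_sub_le _).trans ?_) (by positivity)
    rcases Nat.eq_zero_or_pos (N n) with h | h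
    · simp [h, Real.log_natCast_nonneg]
    · gcongr
      exact hN n
  have h2 : Tendsto (fun n : ℕ => ((N n : ℝ) / n) * Real.log ((N n : ℝ) / n)) atTop
      (𝓝 (q * Real.log q)) :=
    (Real.continuous_mul_log.tendsto q).comp hq
  have h3 := h1.add h2
  rw [zero_add] at h3
  refine h3.congr fun n => ?_
  rcases Nat.eq_zero_or_pos (N n) with h | h
  · simp [h]
  · have hn : (n : ℝ) ≠ 0 := Nat.cast_ne_zero.mpr (h.trans_le (hN n)).ne'
    rw [Real.log_div (by positivity) hn]
    field_simp
    ring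

/-- Integer contingency tables with prescribed nearly equal margins approximating a doubly
stochastic matrix. -/
lemma exists_tables {κ : Type*} [Fintype κ] [DecidableEq κ] [Nonempty κ]
    (C : ℕ → κ → ℕ) {x : ℝ}
    (hC : ∀ a, Tendsto (fun n : ℕ => (C n a : ℝ) / n) atTop (𝓝 x))
    (p : Matrix κ κ ℝ) (hp : p ∈ doublyStochastic ℝ κ) :
    ∃ N : ℕ → κ → κ → ℕ, (∀ n a, ∑ b, N n a b = C n a) ∧ (∀ n b, ∑ a, N n a b = C n b) ∧
      ∀ a b, Tendsto (fun n : ℕ => (N n a b : ℝ) / n) atTop (𝓝 (x * p a b)) := by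
  obtain ⟨w, hw0, hw1, hwp⟩ := exists_eq_sum_perm_of_mem_doublyStochastic hp
  let m : ℕ → ℝ := fun n => Finset.univ.inf' Finset.univ_nonempty fun a => (C n a : ℝ) / n
  have hm : Tendsto m atTop (𝓝 x) := by
    have := Filter.Tendsto.finset_inf'_nhds_apply (s := (Finset.univ : Finset κ))
      (f := fun a n => (C n a : ℝ) / n) (g := fun _ => x) (l := atTop) Finset.univ_nonempty
      (fun a _ => hC a)
    simpa using this
  have hm0 : ∀ n, 0 ≤ m n := fun n => Finset.le_inf' _ _ fun a _ => by positivity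
  let M : Equiv.Perm κ → ℕ → ℕ := fun σ n => ⌊w σ * m n * n⌋₊
  have hM : ∀ σ, Tendsto (fun n : ℕ => (M σ n : ℝ) / n) atTop (𝓝 (w σ * x)) := by
    intro σ
    have h0 : Tendsto (fun n : ℕ => w σ * m n) atTop (𝓝 (w σ * x)) := hm.const_mul _
    have h1 := h0.sub (tendsto_one_div_atTop_nhds_zero_nat (𝕜 := ℝ))
    rw [sub_zero] at h1
    refine tendsto_of_tendsto_of_tendsto_of_le_of_le' h1 h0 ?_ ?_
    · filter_upwards [eventually_gt_atTop 0] with n hn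
      have hn' : (0 : ℝ) < n := by exact_mod_cast hn
      have := (Nat.lt_floor_add_one (w σ * m n * n)).le
      rw [le_div_iff₀ hn', sub_mul, one_div, inv_mul_cancel₀ hn'.ne']
      linarith
    · filter_upwards [eventually_gt_atTop 0] with n hn
      have hn' : (0 : ℝ) < n := by exact_mod_cast hn
      rw [div_le_iff₀ hn']
      exact Nat.floor_le (mul_nonneg (mul_nonneg (hw0 σ) (hm0 n)) hn'.le)
  have hMC : ∀ n a, ∑ σ, M σ n ≤ C n a := by
    intro n a
    rcases Nat.eq_zero_or_pos n with rfl | hn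
    · simp [M]
    have hn' : (0 : ℝ) < n := by exact_mod_cast hn
    have h1 : ((∑ σ, M σ n : ℕ) : ℝ) ≤ m n * n := by
      push_cast
      calc ∑ σ, (M σ n : ℝ) ≤ ∑ σ, w σ * m n * n :=
            Finset.sum_le_sum fun σ _ =>
              Nat.floor_le (mul_nonneg (mul_nonneg (hw0 σ) (hm0 n)) hn'.le)
        _ = m n * n := by simp_rw [mul_assoc]; rw [← Finset.sum_mul, hw1, one_mul]
    have h2 : m n * n ≤ C n a := by
      rw [← le_div_iff₀ hn']
      exact Finset.inf'_le _ (Finset.mem_univ a)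
    exact_mod_cast h1.trans h2
  refine ⟨fun n a b => ∑ σ, (if σ a = b then M σ n else 0) +
    if a = b then C n a - ∑ σ, M σ n else 0, fun n a => ?_, fun n b => ?_, fun a b => ?_⟩
  · rw [Finset.sum_add_distrib, Finset.sum_comm]
    simp [Nat.add_sub_cancel' (hMC n a)]
  · rw [Finset.sum_add_distrib, Finset.sum_comm]
    have : ∀ σ : Equiv.Perm κ, ∑ a, (if σ a = b then M σ n else 0) = M σ n := by
      intro σ
      simp_rw [← Equiv.eq_symm_apply]
      simp
    simp [this, Nat.add_sub_cancel' (hMC n b)]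
  · have h1 : Tendsto (fun n : ℕ => ∑ σ : Equiv.Perm κ, (if σ a = b then (M σ n : ℝ) / n else 0) +
        if a = b then (C n a : ℝ) / n - ∑ σ, (M σ n : ℝ) / n else 0) atTop
        (𝓝 (∑ σ : Equiv.Perm κ, (if σ a = b then w σ * x else 0) +
          if a = b then x - ∑ σ, w σ * x else 0)) := by
      refine (tendsto_finsetSum _ fun σ _ => ?_).add ?_
      · split_ifs
        · exact hM σ
        · exact tendsto_const_nhds
      · split_ifs
        · exact (hC a).sub (tendsto_finsetSum _ fun σ _ => hM σ)
        · exact tendsto_const_nhds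
    have h2 : ∑ σ : Equiv.Perm κ, (if σ a = b then w σ * x else 0) +
          (if a = b then x - ∑ σ, w σ * x else 0) = x * p a b := by
      rw [← Finset.sum_mul, hw1, one_mul, sub_self, ite_self, add_zero, ← hwp, Matrix.sum_apply,
        Finset.mul_sum]
      refine Finset.sum_congr rfl fun σ _ => ?_
      simp [Equiv.Perm.permMatrix, PEquiv.toMatrix_apply, mul_comm]
    rw [h2] at h1
    refine h1.congr fun n => ?_
    rw [Nat.cast_add, Nat.cast_sum, add_div, Finset.sum_div]
    congr 1
    · refine Finset.sum_congr rfl fun σ _ => ?_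
      split_ifs <;> simp
    · split_ifs
      · rw [Nat.cast_sub (hMC n a), sub_div, Nat.cast_sum, Finset.sum_div]
      · simp

/-- Asymptotics of block permanents of doubly stochastic matrices. -/
lemma tendsto_log_sum_perm_prod {κ : Type*} [Fintype κ] [DecidableEq κ] [Nonempty κ]
    (c : ∀ n, Fin n → κ)
    (hc : ∀ a, Tendsto (fun n : ℕ => (Fintype.card {i // c n i = a} : ℝ) / n) atTop
      (𝓝 (Fintype.card κ : ℝ)⁻¹))
    (p : Matrix κ κ ℝ) (hp : p ∈ doublyStochastic ℝ κ) (hpos : ∀ a b, 0 < p a b) :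
    Tendsto (fun n : ℕ => (Real.log (∑ π : Equiv.Perm (Fin n), ∏ i, p (c n i) (c n (π i))) -
      Real.log n.factorial) / n) atTop (𝓝 (-Real.log (Fintype.card κ))) := by
  set K : ℝ := (Fintype.card κ : ℝ) with hK
  have hK0 : 0 < K := by rw [hK]; exact_mod_cast Fintype.card_pos
  let C : ℕ → κ → ℕ := fun n a => Fintype.card {i // c n i = a}
  obtain ⟨N, hrow, hcol, hN⟩ := exists_tables C hc p hp
  have hCsum : ∀ n, ∑ a, C n a = n := fun n => by
    have := Fintype.card_congr (Equiv.sigmaFiberEquiv (c n))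
    rw [Fintype.card_sigma, Fintype.card_fin] at this
    exact this
  have hCle : ∀ a n, C n a ≤ n := fun a n =>
    (Finset.single_le_sum (fun _ _ => Nat.zero_le _) (Finset.mem_univ a)).trans (hCsum n).le
  have hNle : ∀ q : κ × κ, ∀ n, N n q.1 q.2 ≤ n := fun q n =>
    ((Finset.single_le_sum (f := fun b => N n q.1 b) (fun _ _ => Nat.zero_le _)
      (Finset.mem_univ q.2)).trans (hrow n q.1).le).trans (hCle _ n)
  have hNsum : ∀ n, ∑ q : κ × κ, N n q.1 q.2 = n := fun n => by
    rw [Fintype.sum_prod_type]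
    simp_rw [hrow]
    exact hCsum n
  let L : ℕ → ℕ → ℝ := fun m n => (Real.log m.factorial - m * Real.log n + m) / n
  have hLC : ∀ a, Tendsto (fun n => L (C n a) n) atTop (𝓝 (K⁻¹ * Real.log K⁻¹)) :=
    fun a => tendsto_log_factorial (fun n => C n a) (hCle a) (hc a)
  have hLn : Tendsto (fun n => L n n) atTop (𝓝 0) := by
    have := tendsto_log_factorial (fun n => n) (fun _ => le_rfl) (q := 1) (by
      refine tendsto_const_nhds.congr' ?_
      filter_upwards [eventually_ne_atTop 0] with n hn
      rw [div_self (by exact_mod_cast hn)])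
    simpa using this
  have hLN : ∀ q : κ × κ, Tendsto (fun n => L (N n q.1 q.2) n) atTop
      (𝓝 (K⁻¹ * p q.1 q.2 * Real.log (K⁻¹ * p q.1 q.2))) :=
    fun q => tendsto_log_factorial (fun n => N n q.1 q.2) (hNle q) (hN q.1 q.2)
  have hdist : ∀ {α : Type _} [Fintype α] (m : α → ℕ) (n : ℕ), ∑ a, m a = n →
      ∑ a, L (m a) n = ((∑ a, Real.log (m a).factorial) - n * Real.log n + n) / n := by
    intro α _ m n h
    have h' : ∑ a, (m a : ℝ) = n := by exact_mod_cast h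
    simp only [L]
    rw [← Finset.sum_div, Finset.sum_add_distrib, Finset.sum_sub_distrib, ← Finset.sum_mul, h']
  have hpsum : ∑ q : κ × κ, p q.1 q.2 = K := by
    rw [Fintype.sum_prod_type]
    simp_rw [sum_row_of_mem_doublyStochastic hp]
    simp [hK]
  have hSpos : ∀ n, 0 < ∑ π : Equiv.Perm (Fin n), ∏ i, p (c n i) (c n (π i)) := fun n =>
    Finset.sum_pos (fun π _ => Finset.prod_pos fun i _ => hpos _ _) Finset.univ_nonempty
  have hupper : Tendsto (fun n => ∑ a, L (C n a) n - L n n) atTop (𝓝 (-Real.log K)) := by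
    have := (tendsto_finsetSum Finset.univ fun a _ => hLC a).sub hLn
    convert this using 2
    rw [Finset.sum_const, Finset.card_univ, nsmul_eq_mul, ← hK, Real.log_inv]
    field_simp
    ring
  have hlower : Tendsto (fun n => 2 * ∑ a, L (C n a) n - ∑ q : κ × κ, L (N n q.1 q.2) n - L n n
      + ∑ q : κ × κ, (N n q.1 q.2 : ℝ) / n * Real.log (p q.1 q.2)) atTop (𝓝 (-Real.log K)) := by
    have := ((((tendsto_finsetSum Finset.univ fun a _ => hLC a).const_mul 2).sub
      (tendsto_finsetSum Finset.univ fun (q : κ × κ) _ => hLN q)).sub hLn).add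
      (tendsto_finsetSum Finset.univ fun (q : κ × κ) _ => (hN q.1 q.2).mul_const (Real.log (p q.1 q.2)))
    convert this using 2
    have e : ∀ q : κ × κ, K⁻¹ * p q.1 q.2 * Real.log (K⁻¹ * p q.1 q.2) =
        -(K⁻¹ * Real.log K) * p q.1 q.2 + K⁻¹ * p q.1 q.2 * Real.log (p q.1 q.2) := by
      intro q
      rw [Real.log_mul (by positivity) (hpos _ _).ne', Real.log_inv]
      ring
    simp_rw [e]
    rw [Finset.sum_add_distrib,
      ← Finset.mul_sum Finset.univ (fun q : κ × κ => p q.1 q.2), hpsum, Finset.sum_const, Finset.card_univ,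
      nsmul_eq_mul, ← hK, Real.log_inv]
    field_simp
    ring
  refine tendsto_of_tendsto_of_tendsto_of_le_of_le hlower hupper (fun n => ?_) (fun n => ?_)
  · have h := table_le_sum_perm_prod (c n) p (fun a b => (hpos a b).le) (N n) (hrow n) (hcol n)
    have hp1 : 0 < ∏ q : κ × κ, p q.1 q.2 ^ N n q.1 q.2 :=
      Finset.prod_pos fun q _ => pow_pos (hpos _ _) _
    have hf1 : (0 : ℝ) < (∏ a, (Fintype.card {i // c n i = a}).factorial : ℕ) := by
      exact_mod_cast Finset.prod_pos fun a _ => Nat.factorial_pos _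
    have hf2 : (0 : ℝ) < (∏ q : κ × κ, (N n q.1 q.2).factorial : ℕ) := by
      exact_mod_cast Finset.prod_pos fun a _ => Nat.factorial_pos _
    have h2 := Real.log_le_log (by positivity) h
    rw [Real.log_mul (by positivity) hp1.ne', Real.log_mul hf2.ne' (hSpos n).ne', Real.log_pow,
      Nat.cast_prod, Nat.cast_prod, Real.log_prod (by intros; positivity),
      Real.log_prod (by intro q _; exact (pow_pos (hpos _ _) _).ne'),
      Real.log_prod (by intros; positivity)] at h2
    simp_rw [Real.log_pow] at h2
    simp only
    rw [hdist _ n (hCsum n), hdist _ n (hNsum n)]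
    simp only [L]
    simp_rw [div_mul_eq_mul_div]
    rw [← Finset.sum_div, ← mul_div_assoc, ← sub_div, ← sub_div, ← add_div]
    refine div_le_div_of_nonneg_right ?_ (by positivity)
    push_cast at h2
    simp only [C]
    linarith
  · have h := sum_perm_prod_le (c n) p (fun a b => (hpos a b).le)
      (sum_row_of_mem_doublyStochastic hp)
    have h2 := Real.log_le_log (hSpos n) h
    rw [Nat.cast_prod, Real.log_prod (by intros; positivity)] at h2
    simp only
    rw [hdist _ n (hCsum n)]
    simp only [L]
    rw [← sub_div]
    refine div_le_div_of_nonneg_right ?_ (by positivity)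
    simp only [C]
    linarith

end Asymptotics

section Sinkhorn

variable {κ : Type*} [Fintype κ]

/-- The convex potential whose minimisers give the Sinkhorn scaling of `exp ∘ G`. -/
def sinkhornPotential (G : κ → κ → ℝ) (b : κ → ℝ) : ℝ :=
  ∑ i, Real.log (∑ j, Real.exp (G i j + b j)) - ∑ j, b j

lemma sinkhornPotential_sub_const [Nonempty κ] (G : κ → κ → ℝ) (b : κ → ℝ) (t : ℝ) :
    sinkhornPotential G (fun j => b j - t) = sinkhornPotential G b := by
  have h : ∀ i, Real.log (∑ j, Real.exp (G i j + (b j - t))) =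
      Real.log (∑ j, Real.exp (G i j + b j)) - t := by
    intro i
    have h0 : 0 < ∑ j, Real.exp (G i j + b j) :=
      Finset.sum_pos (fun j _ => Real.exp_pos _) Finset.univ_nonempty
    simp_rw [← add_sub_assoc, Real.exp_sub]
    rw [← Finset.sum_div, Real.log_div h0.ne' (Real.exp_pos t).ne', Real.log_exp]
  simp only [sinkhornPotential, h, Finset.sum_sub_distrib]
  ring

lemma le_sinkhornPotential (G : κ → κ → ℝ) {M : ℝ} (hM : ∀ i j, -M ≤ G i j)
    (b : κ → ℝ) {j₀ : κ} (hj₀ : ∀ j, b j ≤ b j₀) (j₁ : κ) :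
    b j₀ - b j₁ - Fintype.card κ * M ≤ sinkhornPotential G b := by
  have h1 : ∀ i, -M + b j₀ ≤ Real.log (∑ j, Real.exp (G i j + b j)) := by
    intro i
    rw [Real.le_log_iff_exp_le (Finset.sum_pos (fun j _ => Real.exp_pos _) ⟨j₀, by simp⟩)]
    calc Real.exp (-M + b j₀) ≤ Real.exp (G i j₀ + b j₀) := by gcongr; exact hM i j₀
      _ ≤ _ := Finset.single_le_sum (f := fun j => Real.exp (G i j + b j))
        (fun j _ => (Real.exp_pos _).le) (Finset.mem_univ j₀)
  have h2 : b j₀ - b j₁ ≤ ∑ j, (b j₀ - b j) :=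
    Finset.single_le_sum (f := fun j => b j₀ - b j) (fun j _ => sub_nonneg.2 (hj₀ j))
      (Finset.mem_univ j₁)
  have h3 := Finset.sum_le_sum fun i (_ : i ∈ Finset.univ) => h1 i
  simp only [Finset.sum_sub_distrib, Finset.sum_const, Finset.card_univ, nsmul_eq_mul] at h2 h3
  simp only [sinkhornPotential]
  linarith

lemma continuous_sinkhornPotential [Nonempty κ] (G : κ → κ → ℝ) :
    Continuous (sinkhornPotential G) := by
  refine Continuous.sub (continuous_finsetSum _ fun i _ => Continuous.log (by fun_prop) fun b => ?_)
    (by fun_prop)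
  exact (Finset.sum_pos (fun j _ => Real.exp_pos _) Finset.univ_nonempty).ne'

lemma exists_min_sinkhornPotential [Nonempty κ] (G : κ → κ → ℝ) :
    ∃ b, ∀ b', sinkhornPotential G b ≤ sinkhornPotential G b' := by
  obtain ⟨M, hM0, hM⟩ : ∃ M : ℝ, 0 ≤ M ∧ ∀ i j, -M ≤ G i j := by
    refine ⟨∑ i, ∑ j, |G i j|, by positivity, fun i j => ?_⟩
    have h1 : |G i j| ≤ ∑ j, |G i j| :=
      Finset.single_le_sum (f := fun j => |G i j|) (fun _ _ => abs_nonneg _) (Finset.mem_univ j)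
    have h2 : ∑ j, |G i j| ≤ ∑ i, ∑ j, |G i j| :=
      Finset.single_le_sum (f := fun i => ∑ j, |G i j|)
        (fun _ _ => Finset.sum_nonneg fun _ _ => abs_nonneg _) (Finset.mem_univ i)
    linarith [neg_abs_le (G i j)]
  set R : ℝ := |sinkhornPotential G 0| + Fintype.card κ * M with hR
  have hR0 : 0 ≤ R := by positivity
  have hne : (0 : κ → ℝ) ∈ Set.Icc (fun _ : κ => -R) (fun _ => 0) :=
    ⟨fun _ => neg_nonpos.2 hR0, fun _ => le_rfl⟩
  obtain ⟨b, -, hmin⟩ := isCompact_Icc.exists_isMinOn ⟨_, hne⟩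
    (continuous_sinkhornPotential G).continuousOn
  refine ⟨b, fun b' => ?_⟩
  obtain ⟨j₀, hj₀⟩ := Finite.exists_max b'
  by_cases h : ∀ j, -R ≤ b' j - b' j₀
  · rw [← sinkhornPotential_sub_const G b' (b' j₀)]
    exact hmin ⟨h, fun j => sub_nonpos.2 (hj₀ j)⟩
  · push Not at h
    obtain ⟨j₁, hj₁⟩ := h
    have h1 := le_sinkhornPotential G hM b' hj₀ j₁
    have h2 : sinkhornPotential G b ≤ sinkhornPotential G 0 := hmin hne
    linarith [le_abs_self (sinkhornPotential G 0)]

/-- **Sinkhorn scaling**: every matrix with positive entries can be scaled to a doubly stochastic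
one. -/
theorem exists_sinkhorn [DecidableEq κ] [Nonempty κ] (G : κ → κ → ℝ) :
    ∃ α β : κ → ℝ, Matrix.of (fun a b => Real.exp (G a b + α a + β b)) ∈ doublyStochastic ℝ κ := by
  obtain ⟨b, hb⟩ := exists_min_sinkhornPotential G
  have hS : ∀ i, 0 < ∑ j, Real.exp (G i j + b j) := fun i =>
    Finset.sum_pos (fun j _ => Real.exp_pos _) Finset.univ_nonempty
  have hent : ∀ i j, Real.exp (G i j + -Real.log (∑ j, Real.exp (G i j + b j)) + b j) =
      Real.exp (G i j + b j) / ∑ j, Real.exp (G i j + b j) := by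
    intro i j
    rw [add_right_comm, ← sub_eq_add_neg, Real.exp_sub, Real.exp_log (hS i)]
  refine ⟨fun i => -Real.log (∑ j, Real.exp (G i j + b j)), b, ?_⟩
  rw [mem_doublyStochastic_iff_sum]
  refine ⟨fun i j => (Real.exp_pos _).le, fun i => ?_, fun j => ?_⟩
  · simp only [Matrix.of_apply, hent]
    rw [← Finset.sum_div, div_self (hS i).ne']
  · simp only [Matrix.of_apply, hent]
    have hd : HasDerivAt (fun t : ℝ => sinkhornPotential G (fun l => b l + t * (Pi.single j 1 : κ → ℝ) l))
        (∑ i, Real.exp (G i j + b j) / ∑ l, Real.exp (G i l + b l) - 1) 0 := by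
      have hl : ∀ l, HasDerivAt (fun t : ℝ => b l + t * (Pi.single j 1 : κ → ℝ) l)
          ((Pi.single j 1 : κ → ℝ) l) 0 := fun l => by
        simpa using ((hasDerivAt_id (0 : ℝ)).mul_const
          ((Pi.single j 1 : κ → ℝ) l)).const_add (b l)
      have h1 : ∀ i, HasDerivAt
          (fun t : ℝ => Real.log (∑ l, Real.exp (G i l + (b l + t * (Pi.single j 1 : κ → ℝ) l))))
          (Real.exp (G i j + b j) / ∑ l, Real.exp (G i l + b l)) 0 := by
        intro i
        have h2 := (HasDerivAt.fun_sum (u := Finset.univ)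
          fun l _ => ((hl l).const_add (G i l)).exp).log (by simpa using (hS i).ne')
        convert h2 using 1
        simp [Pi.single_apply]
      have h3 := (HasDerivAt.fun_sum (u := Finset.univ) fun i _ => h1 i).sub
        (HasDerivAt.fun_sum (u := Finset.univ) fun l _ => hl l)
      rw [Fintype.sum_pi_single'] at h3
      exact h3
    have hmin : IsLocalMin (fun t : ℝ => sinkhornPotential G (fun l => b l + t * (Pi.single j 1 : κ → ℝ) l))
        0 := Filter.Eventually.of_forall fun t => by
      simpa using hb (fun l => b l + t * (Pi.single j 1 : κ → ℝ) l)
    have := hmin.hasDerivAt_eq_zero hd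
    linarith

end Sinkhorn

section Variational

instance isProbabilityMeasure_unif01 : IsProbabilityMeasure unif01 :=
  ⟨by simp [unif01]⟩

instance isProbabilityMeasure_usq : IsProbabilityMeasure usq := by
  unfold usq; infer_instance

lemma integrable_comp_of_finite {Ω S : Type*} [MeasurableSpace Ω] [Finite S] [MeasurableSpace S]
    [MeasurableSingletonClass S] {ν : Measure Ω} [IsFiniteMeasure ν] {χ : Ω → S}
    (hχ : Measurable χ) (φ : S → ℝ) : Integrable (fun x => φ (χ x)) ν :=
  (Integrable.of_finite (f := φ) (μ := ν.map χ)).comp_measurable hχ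

variable {κ : Type*} [Fintype κ] [MeasurableSpace κ] [MeasurableSingletonClass κ]
  {ψ : ℝ → κ}

lemma integral_comp_unif01 (hψ : Measurable ψ)
    (hunif : ∀ a, unif01.real (ψ ⁻¹' {a}) = (Fintype.card κ : ℝ)⁻¹) (φ : κ → ℝ) :
    ∫ x, φ (ψ x) ∂unif01 = (Fintype.card κ : ℝ)⁻¹ * ∑ a, φ a := by
  rw [← integral_map (f := φ) hψ.aemeasurable (Measurable.of_discrete).aestronglyMeasurable,
    integral_fintype Integrable.of_finite, Finset.mul_sum]
  refine Finset.sum_congr rfl fun a _ => ?_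
  rw [map_measureReal_apply hψ (measurableSet_singleton a), hunif, smul_eq_mul]

lemma integral_add_marginals (hψ : Measurable ψ)
    (hunif : ∀ a, unif01.real (ψ ⁻¹' {a}) = (Fintype.card κ : ℝ)⁻¹)
    {μ : Measure (ℝ × ℝ)} (hμ : μ ∈ MM) (G : κ → κ → ℝ) (α β : κ → ℝ) (t : ℝ) :
    ∫ q, (t + G (ψ q.1) (ψ q.2) + α (ψ q.1) + β (ψ q.2)) ∂μ =
      t + ∫ q, G (ψ q.1) (ψ q.2) ∂μ + (Fintype.card κ : ℝ)⁻¹ * (∑ a, α a + ∑ a, β a) := by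
  obtain ⟨hprob, h1, h2⟩ := hμ
  have m1 : Measurable fun q : ℝ × ℝ => ψ q.1 := hψ.comp measurable_fst
  have m2 : Measurable fun q : ℝ × ℝ => ψ q.2 := hψ.comp measurable_snd
  have i1 := integrable_comp_of_finite (ν := μ) m1 α
  have i2 := integrable_comp_of_finite (ν := μ) m2 β
  have i0 : Integrable (fun q : ℝ × ℝ => t + G (ψ q.1) (ψ q.2)) μ :=
    integrable_comp_of_finite (m1.prodMk m2) (fun s => t + G s.1 s.2)
  have i01 : Integrable (fun q : ℝ × ℝ => t + G (ψ q.1) (ψ q.2) + α (ψ q.1)) μ := i0.add i1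
  have i00 : Integrable (fun q : ℝ × ℝ => G (ψ q.1) (ψ q.2)) μ :=
    integrable_comp_of_finite (m1.prodMk m2) (fun s => G s.1 s.2)
  have e1 : ∫ q, α (ψ q.1) ∂μ = (Fintype.card κ : ℝ)⁻¹ * ∑ a, α a := by
    rw [← integral_comp_unif01 hψ hunif, ← h1,
      integral_map (f := fun x => α (ψ x)) measurable_fst.aemeasurable
        ((Measurable.of_discrete (f := α)).comp hψ).aestronglyMeasurable]
  have e2 : ∫ q, β (ψ q.2) ∂μ = (Fintype.card κ : ℝ)⁻¹ * ∑ a, β a := by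
    rw [← integral_comp_unif01 hψ hunif, ← h2,
      integral_map (f := fun x => β (ψ x)) measurable_snd.aemeasurable
        ((Measurable.of_discrete (f := β)).comp hψ).aestronglyMeasurable]
  rw [integral_add i01 i2, integral_add i0 i1, integral_add (integrable_const t) i00, e1, e2]
  simp
  ring

variable [Nonempty κ] [DecidableEq κ]

/-- The logarithm of the block density attached to a doubly stochastic scaling. -/
def logBlockDensity (ψ : ℝ → κ) (G : κ → κ → ℝ) (α β : κ → ℝ) (q : ℝ × ℝ) : ℝ :=
  Real.log (Fintype.card κ) + G (ψ q.1) (ψ q.2) + α (ψ q.1) + β (ψ q.2)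

omit [MeasurableSpace κ] [MeasurableSingletonClass κ] [DecidableEq κ] in
lemma exp_logBlockDensity (G : κ → κ → ℝ) (α β : κ → ℝ) (q : ℝ × ℝ) :
    Real.exp (logBlockDensity ψ G α β q) =
      Fintype.card κ * Real.exp (G (ψ q.1) (ψ q.2) + α (ψ q.1) + β (ψ q.2)) := by
  have : (0 : ℝ) < Fintype.card κ := by exact_mod_cast Fintype.card_pos
  rw [logBlockDensity, add_assoc, add_assoc, Real.exp_add, Real.exp_log this, add_assoc]

variable {G : κ → κ → ℝ} {α β : κ → ℝ}

omit [DecidableEq κ] [Nonempty κ] in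
lemma integrable_comp_logBlockDensity (hψ : Measurable ψ) (ν : Measure (ℝ × ℝ))
    [IsFiniteMeasure ν] (u : ℝ → ℝ) :
    Integrable (fun q => u (logBlockDensity ψ G α β q)) ν :=
  integrable_comp_of_finite ((hψ.comp measurable_fst).prodMk (hψ.comp measurable_snd))
    (fun s : κ × κ => u (Real.log (Fintype.card κ) + G s.1 s.2 + α s.1 + β s.2))

lemma integral_exp_logBlockDensity_left (hψ : Measurable ψ)
    (hunif : ∀ a, unif01.real (ψ ⁻¹' {a}) = (Fintype.card κ : ℝ)⁻¹)
    (hds : Matrix.of (fun a b => Real.exp (G a b + α a + β b)) ∈ doublyStochastic ℝ κ) (y : ℝ) :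
    ∫ x, Real.exp (logBlockDensity ψ G α β (x, y)) ∂unif01 = 1 := by
  have hK : (0 : ℝ) < Fintype.card κ := by exact_mod_cast Fintype.card_pos
  simp_rw [exp_logBlockDensity]
  rw [integral_comp_unif01 hψ hunif
    (fun a => Fintype.card κ * Real.exp (G a (ψ y) + α a + β (ψ y))), ← Finset.mul_sum]
  have := sum_col_of_mem_doublyStochastic hds (ψ y)
  simp only [Matrix.of_apply] at this
  rw [this]
  field_simp

lemma integral_exp_logBlockDensity_right (hψ : Measurable ψ)
    (hunif : ∀ a, unif01.real (ψ ⁻¹' {a}) = (Fintype.card κ : ℝ)⁻¹)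
    (hds : Matrix.of (fun a b => Real.exp (G a b + α a + β b)) ∈ doublyStochastic ℝ κ) (x : ℝ) :
    ∫ y, Real.exp (logBlockDensity ψ G α β (x, y)) ∂unif01 = 1 := by
  have hK : (0 : ℝ) < Fintype.card κ := by exact_mod_cast Fintype.card_pos
  simp_rw [exp_logBlockDensity]
  rw [integral_comp_unif01 hψ hunif
    (fun b => Fintype.card κ * Real.exp (G (ψ x) b + α (ψ x) + β b)), ← Finset.mul_sum]
  have := sum_row_of_mem_doublyStochastic hds (ψ x)
  simp only [Matrix.of_apply] at this
  rw [this]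
  field_simp

lemma integral_exp_logBlockDensity (hψ : Measurable ψ)
    (hunif : ∀ a, unif01.real (ψ ⁻¹' {a}) = (Fintype.card κ : ℝ)⁻¹)
    (hds : Matrix.of (fun a b => Real.exp (G a b + α a + β b)) ∈ doublyStochastic ℝ κ) :
    ∫ q, Real.exp (logBlockDensity ψ G α β q) ∂usq = 1 := by
  rw [usq, integral_prod _ (integrable_comp_logBlockDensity hψ usq Real.exp)]
  simp_rw [integral_exp_logBlockDensity_right hψ hunif hds]
  simp

omit [Nonempty κ] [DecidableEq κ] in
lemma measurable_logBlockDensity (hψ : Measurable ψ) :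
    Measurable (logBlockDensity ψ G α β) :=
  (Measurable.of_discrete (f := fun s : κ × κ =>
    Real.log (Fintype.card κ) + G s.1 s.2 + α s.1 + β s.2)).comp
      ((hψ.comp measurable_fst).prodMk (hψ.comp measurable_snd))

lemma tilted_logBlockDensity_mem_MM (hψ : Measurable ψ)
    (hunif : ∀ a, unif01.real (ψ ⁻¹' {a}) = (Fintype.card κ : ℝ)⁻¹)
    (hds : Matrix.of (fun a b => Real.exp (G a b + α a + β b)) ∈ doublyStochastic ℝ κ) :
    usq.tilted (logBlockDensity ψ G α β) ∈ MM := by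
  have hm := measurable_logBlockDensity (G := G) (α := α) (β := β) hψ
  have hmE : Measurable fun q : ℝ × ℝ =>
    ENNReal.ofReal (Real.exp (logBlockDensity ψ G α β q)) := by fun_prop
  have hright : ∀ x, ∫⁻ y, ENNReal.ofReal (Real.exp (logBlockDensity ψ G α β (x, y))) ∂unif01
      = 1 := fun x => by
    rw [← ofReal_integral_eq_lintegral_ofReal, integral_exp_logBlockDensity_right hψ hunif hds,
      ENNReal.ofReal_one]
    · exact integrable_comp_of_finite hψ (fun b => Real.exp (Real.log (Fintype.card κ) +
        G (ψ x) b + α (ψ x) + β b))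
    · exact ae_of_all _ fun y => (Real.exp_pos _).le
  have hleft : ∀ y, ∫⁻ x, ENNReal.ofReal (Real.exp (logBlockDensity ψ G α β (x, y))) ∂unif01
      = 1 := fun y => by
    rw [← ofReal_integral_eq_lintegral_ofReal, integral_exp_logBlockDensity_left hψ hunif hds,
      ENNReal.ofReal_one]
    · exact integrable_comp_of_finite hψ (fun a => Real.exp (Real.log (Fintype.card κ) +
        G a (ψ y) + α a + β (ψ y)))
    · exact ae_of_all _ fun y => (Real.exp_pos _).le
  refine ⟨isProbabilityMeasure_tilted (integrable_comp_logBlockDensity hψ usq Real.exp), ?_, ?_⟩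
  · ext s hs
    rw [Measure.map_apply measurable_fst hs, tilted_apply' _ _ (measurable_fst hs),
      integral_exp_logBlockDensity hψ hunif hds]
    simp_rw [div_one]
    rw [← Set.prod_univ, usq, ← Measure.prod_restrict, lintegral_prod _ hmE.aemeasurable]
    simp_rw [Measure.restrict_univ, hright]
    simp
  · ext s hs
    rw [Measure.map_apply measurable_snd hs, tilted_apply' _ _ (measurable_snd hs),
      integral_exp_logBlockDensity hψ hunif hds]
    simp_rw [div_one]
    rw [← Set.univ_prod, usq, ← Measure.prod_restrict, lintegral_prod_symm _ hmE.aemeasurable]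
    simp_rw [Measure.restrict_univ, hleft]
    simp

/-- The value of the variational problem for a block potential. -/
def blockValue (α β : κ → ℝ) : ℝ :=
  -Real.log (Fintype.card κ) - (Fintype.card κ : ℝ)⁻¹ * (∑ a, α a + ∑ a, β a)

lemma block_integral_sub_KL_le (hψ : Measurable ψ)
    (hunif : ∀ a, unif01.real (ψ ⁻¹' {a}) = (Fintype.card κ : ℝ)⁻¹)
    (hds : Matrix.of (fun a b => Real.exp (G a b + α a + β b)) ∈ doublyStochastic ℝ κ)
    {μ : Measure (ℝ × ℝ)} (hμ : μ ∈ MM) (hKL : KL μ usq ≠ ⊤) :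
    ∫ q, G (ψ q.1) (ψ q.2) ∂μ - (KL μ usq).toReal ≤ blockValue α β := by
  have hcond : μ ≪ usq ∧ Integrable (fun x => Real.log ((μ.rnDeriv usq x).toReal)) μ := by
    by_contra h
    exact hKL (if_neg h)
  have hint : Integrable (llr μ usq) μ := hcond.2
  have := hμ.1
  have hE := integrable_comp_logBlockDensity (G := G) (α := α) (β := β) hψ usq Real.exp
  have hEμ : Integrable (logBlockDensity ψ G α β) μ := integrable_comp_logBlockDensity hψ μ id
  have := isProbabilityMeasure_tilted hE
  have hac := hcond.1.trans (absolutelyContinuous_tilted hE)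
  have h1 := InformationTheory.integral_llr_add_sub_measure_univ_nonneg hac
    (integrable_llr_tilted_right hcond.1 hEμ hint hE)
  rw [integral_llr_tilted_right hcond.1 hEμ hE hint,
    integral_exp_logBlockDensity hψ hunif hds] at h1
  have h2 : ∫ x, llr μ usq x ∂μ ≤ (KL μ usq).toReal := by
    rw [KL, if_pos hcond, ENNReal.toReal_ofReal']
    exact le_max_left _ _
  have h3 := integral_add_marginals hψ hunif hμ G α β (Real.log (Fintype.card κ))
  simp only [logBlockDensity] at h1
  rw [h3] at h1
  simp only [probReal_univ, Real.log_one] at h1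
  rw [blockValue]
  linarith

lemma KL_tilted_logBlockDensity (hψ : Measurable ψ)
    (hunif : ∀ a, unif01.real (ψ ⁻¹' {a}) = (Fintype.card κ : ℝ)⁻¹)
    (hds : Matrix.of (fun a b => Real.exp (G a b + α a + β b)) ∈ doublyStochastic ℝ κ) :
    KL (usq.tilted (logBlockDensity ψ G α β)) usq = ENNReal.ofReal
      (∫ q, G (ψ q.1) (ψ q.2) ∂(usq.tilted (logBlockDensity ψ G α β)) - blockValue α β) ∧
    blockValue α β ≤ ∫ q, G (ψ q.1) (ψ q.2) ∂(usq.tilted (logBlockDensity ψ G α β)) := by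
  set ν := usq.tilted (logBlockDensity ψ G α β) with hν
  have hMM : ν ∈ MM := tilted_logBlockDensity_mem_MM hψ hunif hds
  have := hMM.1
  have hE := integrable_comp_logBlockDensity (G := G) (α := α) (β := β) hψ usq Real.exp
  have hac : ν ≪ usq := tilted_absolutelyContinuous _ _
  have hlog : (fun q => Real.log ((ν.rnDeriv usq q).toReal)) =ᵐ[ν] logBlockDensity ψ G α β := by
    filter_upwards [hac.ae_le (log_rnDeriv_tilted_left_self hE)] with q hq
    rw [integral_exp_logBlockDensity hψ hunif hds, Real.log_one, sub_zero] at hq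
    exact hq
  have hint : Integrable (fun q => Real.log ((ν.rnDeriv usq q).toReal)) ν :=
    (integrable_comp_logBlockDensity (G := G) (α := α) (β := β) hψ ν id).congr hlog.symm
  have hval : ∫ q, Real.log ((ν.rnDeriv usq q).toReal) ∂ν =
      ∫ q, G (ψ q.1) (ψ q.2) ∂ν - blockValue α β := by
    rw [integral_congr_ae hlog]
    have h3 := integral_add_marginals hψ hunif hMM G α β (Real.log (Fintype.card κ))
    simp only [logBlockDensity, blockValue]
    rw [h3]
    ring
  refine ⟨by rw [KL, if_pos ⟨hac, hint⟩, hval], ?_⟩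
  have h1 := InformationTheory.integral_llr_add_sub_measure_univ_nonneg hac hint
  simp only [probReal_univ] at h1
  simp only [llr_def] at h1
  rw [hval] at h1
  linarith

lemma ae_mem_unitSq {μ : Measure (ℝ × ℝ)} (hμ : μ ∈ MM) : ∀ᵐ q ∂μ, q ∈ unitSq := by
  have h0 : ∀ᵐ x ∂unif01, x ∈ Set.Icc (0 : ℝ) 1 := ae_restrict_mem measurableSet_Icc
  have h1 := ae_of_ae_map measurable_fst.aemeasurable (hμ.2.1.symm ▸ h0)
  have h2 := ae_of_ae_map measurable_snd.aemeasurable (hμ.2.2.symm ▸ h0)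
  filter_upwards [h1, h2] with q hq1 hq2 using ⟨hq1, hq2⟩

lemma isCompact_unitSq : IsCompact unitSq := isCompact_Icc.prod isCompact_Icc

lemma integrable_of_continuousOn_unitSq {f : ℝ × ℝ → ℝ} (hf : ContinuousOn f unitSq)
    {μ : Measure (ℝ × ℝ)} (hμ : μ ∈ MM) : Integrable f μ := by
  have := hμ.1
  have h := hf.integrableOn_compact (μ := μ) isCompact_unitSq
  rwa [IntegrableOn, Measure.restrict_eq_self_of_ae_mem (ae_mem_unitSq hμ)] at h

/-- The variational problem for `θ f` is within `ε` of the block value, when `θ f` is within `ε` of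
the block potential. -/
lemma iSup_objE_near (hψ : Measurable ψ)
    (hunif : ∀ a, unif01.real (ψ ⁻¹' {a}) = (Fintype.card κ : ℝ)⁻¹)
    (hds : Matrix.of (fun a b => Real.exp (G a b + α a + β b)) ∈ doublyStochastic ℝ κ)
    {f : ℝ × ℝ → ℝ} (hf : ContinuousOn f unitSq) {θ ε : ℝ}
    (hε : ∀ q ∈ unitSq, |θ * f q - G (ψ q.1) (ψ q.2)| ≤ ε) :
    (⨆ μ ∈ MM, objE f θ μ) ≤ ((blockValue α β + ε : ℝ) : EReal) ∧
      ((blockValue α β - ε : ℝ) : EReal) ≤ ⨆ μ ∈ MM, objE f θ μ := by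
  have hclose : ∀ μ ∈ MM, |θ * ∫ q, f q ∂μ - ∫ q, G (ψ q.1) (ψ q.2) ∂μ| ≤ ε := by
    intro μ hμ
    have := hμ.1
    have i1 := (integrable_of_continuousOn_unitSq hf hμ).const_mul θ
    have i2 : Integrable (fun q : ℝ × ℝ => G (ψ q.1) (ψ q.2)) μ :=
      integrable_comp_of_finite ((hψ.comp measurable_fst).prodMk (hψ.comp measurable_snd))
        (fun s : κ × κ => G s.1 s.2)
    rw [← integral_const_mul, ← integral_sub i1 i2]
    have := norm_integral_le_of_norm_le_const (μ := μ) (C := ε)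
      (f := fun q => θ * f q - G (ψ q.1) (ψ q.2)) (by
        filter_upwards [ae_mem_unitSq hμ] with q hq using hε q hq)
    simpa using this
  constructor
  · refine iSup₂_le fun μ hμ => ?_
    by_cases hKL : KL μ usq = ⊤
    · simp [objE, hKL]
    · have h1 := block_integral_sub_KL_le hψ hunif hds hμ hKL
      have h2 := (abs_le.1 (hclose μ hμ)).2
      rw [objE, ← EReal.coe_ennreal_toReal hKL, ← EReal.coe_sub, EReal.coe_le_coe_iff]
      linarith
  · have hMM := tilted_logBlockDensity_mem_MM hψ hunif hds
    obtain ⟨h1, h2⟩ := KL_tilted_logBlockDensity hψ hunif hds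
    refine le_trans ?_ (le_iSup₂ (f := fun μ (_ : μ ∈ MM) => objE f θ μ) _ hMM)
    have h3 := (abs_le.1 (hclose _ hMM)).1
    rw [objE, h1, EReal.coe_ennreal_ofReal, ← EReal.coe_sub, EReal.coe_le_coe_iff,
      max_eq_left (by linarith)]
    linarith

end Variational

section Grid

/-- The limiting log partition function of a block potential. -/
lemma tendsto_log_sum_exp_block {κ : Type*} [Fintype κ] [DecidableEq κ] [Nonempty κ]
    (c : ∀ n, Fin n → κ)
    (hc : ∀ a, Tendsto (fun n : ℕ => (Fintype.card {i // c n i = a} : ℝ) / n) atTop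
      (𝓝 (Fintype.card κ : ℝ)⁻¹))
    {G : κ → κ → ℝ} {α β : κ → ℝ}
    (hds : Matrix.of (fun a b => Real.exp (G a b + α a + β b)) ∈ doublyStochastic ℝ κ) :
    Tendsto (fun n : ℕ => (Real.log (∑ π : Equiv.Perm (Fin n),
      Real.exp (∑ i, G (c n i) (c n (π i)))) - Real.log n.factorial) / n) atTop
      (𝓝 (blockValue α β)) := by
  have h1 := tendsto_log_sum_perm_prod c hc _ hds fun a b => Real.exp_pos _
  have h2 : Tendsto (fun n : ℕ => ∑ a, (Fintype.card {i // c n i = a} : ℝ) / n * (α a + β a))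
      atTop (𝓝 (∑ a, (Fintype.card κ : ℝ)⁻¹ * (α a + β a))) :=
    tendsto_finsetSum _ fun a _ => (hc a).mul_const _
  have h3 := h1.sub h2
  rw [← Finset.mul_sum, Finset.sum_add_distrib] at h3
  refine h3.congr fun n => ?_
  have hS : ∑ a, (Fintype.card {i // c n i = a} : ℝ) / n * (α a + β a) =
      (∑ i, (α (c n i) + β (c n i))) / n := by
    rw [← Finset.sum_fiberwise (s := Finset.univ) (g := c n), Finset.sum_div]
    refine Finset.sum_congr rfl fun a _ => ?_
    rw [Finset.sum_congr rfl (g := fun _ => α a + β a) fun i hi => by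
      rw [(Finset.mem_filter.1 hi).2], Finset.sum_const, nsmul_eq_mul, Fintype.card_subtype]
    ring
  have hP : ∀ π : Equiv.Perm (Fin n),
      ∏ i, Matrix.of (fun a b => Real.exp (G a b + α a + β b)) (c n i) (c n (π i)) =
        Real.exp (∑ i, G (c n i) (c n (π i))) * Real.exp (∑ i, (α (c n i) + β (c n i))) := by
    intro π
    simp only [Matrix.of_apply]
    rw [← Real.exp_sum, ← Real.exp_add]
    simp only [Finset.sum_add_distrib]
    rw [Equiv.sum_comp π fun i => β (c n i), add_assoc]
  rw [Finset.sum_congr rfl fun π _ => hP π, ← Finset.sum_mul, Real.log_mul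
    (Finset.sum_pos (fun π _ => Real.exp_pos _) Finset.univ_nonempty).ne' (Real.exp_pos _).ne',
    Real.log_exp, hS]
  ring

/-- If two potentials differ by at most `B`, so do their log partition functions. -/
lemma abs_log_sum_exp_sub_le {ι : Type*} [Fintype ι] [Nonempty ι] {u v : ι → ℝ} {B : ℝ}
    (h : ∀ i, |u i - v i| ≤ B) :
    |Real.log (∑ i, Real.exp (u i)) - Real.log (∑ i, Real.exp (v i))| ≤ B := by
  have key : ∀ u v : ι → ℝ, (∀ i, u i - v i ≤ B) →
      Real.log (∑ i, Real.exp (u i)) ≤ Real.log (∑ i, Real.exp (v i)) + B := by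
    intro u v h
    have hv : 0 < ∑ i, Real.exp (v i) :=
      Finset.sum_pos (fun i _ => Real.exp_pos _) Finset.univ_nonempty
    rw [← Real.log_exp B, ← Real.log_mul hv.ne' (Real.exp_pos _).ne', Finset.sum_mul]
    refine Real.log_le_log (Finset.sum_pos (fun i _ => Real.exp_pos _) Finset.univ_nonempty)
      (Finset.sum_le_sum fun i _ => ?_)
    rw [← Real.exp_add]
    exact Real.exp_le_exp.2 (by linarith [h i])
  have h1 := key u v fun i => (abs_le.1 (h i)).2
  have h2 := key v u fun i => by linarith [(abs_le.1 (h i)).1]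
  rw [abs_le]
  constructor <;> linarith

variable {k : ℕ} [NeZero k]

/-- The index of the cell of length `1 / k` of `[0,1]` containing a point. -/
def cell (k : ℕ) [NeZero k] (x : ℝ) : Fin k :=
  ⟨min ⌊k * x⌋₊ (k - 1), by have := NeZero.pos k; omega⟩

lemma measurable_cell : Measurable (cell k) :=
  (Measurable.of_discrete (f := fun m : ℕ =>
    (⟨min m (k - 1), by have := NeZero.pos k; omega⟩ : Fin k))).comp
      (Nat.measurable_floor.comp (measurable_const_mul (k : ℝ)))

lemma cell_preimage_inter (a : Fin k) :
    cell k ⁻¹' {a} ∩ Set.Ico 0 1 = Set.Ico ((a : ℝ) / k) ((a + 1 : ℝ) / k) := by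
  have hk : (0 : ℝ) < k := by exact_mod_cast NeZero.pos k
  have ha : (a : ℝ) + 1 ≤ k := by exact_mod_cast a.2
  ext x
  simp only [Set.mem_inter_iff, Set.mem_preimage, Set.mem_singleton_iff, Set.mem_Ico]
  rw [div_le_iff₀ hk, lt_div_iff₀ hk]
  constructor
  · rintro ⟨hx, h0, h1⟩
    have hlt : ⌊k * x⌋₊ < k := (Nat.floor_lt (by positivity)).2 (by nlinarith)
    have hfl : ⌊k * x⌋₊ = a := by
      have := congrArg Fin.val hx
      simp only [cell] at this
      omega
    rw [Nat.floor_eq_iff (by positivity)] at hfl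
    constructor <;> nlinarith
  · rintro ⟨h0, h1⟩
    have hx0 : 0 ≤ x := by
      by_contra! h
      have : (0 : ℝ) ≤ a := by positivity
      nlinarith
    have hfl : ⌊k * x⌋₊ = a := by
      rw [Nat.floor_eq_iff (by positivity)]
      constructor <;> linarith
    refine ⟨Fin.ext ?_, hx0, by nlinarith⟩
    have := a.2
    simp only [cell]
    omega

lemma unif01_real_cell (a : Fin k) :
    unif01.real (cell k ⁻¹' {a}) = (Fintype.card (Fin k) : ℝ)⁻¹ := by
  rw [unif01, ← Measure.restrict_congr_set Ico_ae_eq_Icc,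
    measureReal_restrict_apply (measurable_cell (measurableSet_singleton a)), cell_preimage_inter,
    Real.volume_real_Ico_of_le (by gcongr; linarith), Fintype.card_fin]
  ring

lemma abs_sub_cell_le {x : ℝ} (hx : x ∈ Set.Icc (0 : ℝ) 1) :
    |x - ((cell k x : ℝ) + 1) / k| ≤ 1 / k := by
  have hk : (0 : ℝ) < k := by exact_mod_cast NeZero.pos k
  obtain ⟨h0, h1⟩ := hx
  have hkx : 0 ≤ k * x := by positivity
  have hv : ((cell k x : ℕ) : ℝ) ≤ k * x :=
    le_trans (Nat.cast_le.2 (min_le_left _ _)) (Nat.floor_le hkx)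
  have hv' : k * x ≤ (cell k x : ℕ) + 1 := by
    rcases le_total ⌊k * x⌋₊ (k - 1) with h | h
    · have : (cell k x : ℕ) = ⌊k * x⌋₊ := min_eq_left h
      rw [this]
      exact (Nat.lt_floor_add_one _).le
    · have : (cell k x : ℕ) = k - 1 := min_eq_right h
      rw [this, Nat.cast_pred (NeZero.pos k)]
      nlinarith
  have e : x - ((cell k x : ℝ) + 1) / k = (k * x - ((cell k x : ℕ) + 1)) / k := by
    field_simp
  rw [e, abs_div, abs_of_pos hk]
  gcongr
  rw [abs_le]
  constructor <;> linarith

/-- The index of the block of `Fin n`, cut into `k` blocks of nearly equal size, containing a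
point. -/
def block (k : ℕ) [NeZero k] (n : ℕ) (i : Fin n) : Fin k :=
  ⟨i * k / n, Nat.div_lt_of_lt_mul (Nat.mul_lt_mul_of_pos_right i.2 (NeZero.pos k))⟩

lemma block_eq_iff {n : ℕ} (i : Fin n) (a : Fin k) :
    block k n i = a ↔ a * n ≤ i * k ∧ i * k < (a + 1) * n := by
  have hn : 0 < n := i.pos
  rw [Fin.ext_iff, ← Nat.le_div_iff_mul_le hn, ← Nat.div_lt_iff_lt_mul hn]
  simp only [block]
  omega

lemma card_block (n : ℕ) (a : Fin k) :
    Fintype.card {i // block k n i = a} =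
      ⌈((a + 1 : ℝ) / k) * n⌉₊ - ⌈((a : ℝ) / k) * n⌉₊ := by
  have hk : (0 : ℝ) < k := by exact_mod_cast NeZero.pos k
  have ha : (a : ℝ) + 1 ≤ k := by exact_mod_cast a.2
  rw [Fintype.card_subtype, ← Nat.card_Ico, ← Finset.card_map Fin.valEmbedding]
  congr 1
  have hmem : ∀ m : ℕ, m ∈ Finset.Ico ⌈((a : ℝ) / k) * n⌉₊ ⌈((a + 1 : ℝ) / k) * n⌉₊ ↔
      a * n ≤ m * k ∧ m * k < (a + 1) * n := fun m => by
    rw [Finset.mem_Ico, Nat.ceil_le, Nat.lt_ceil, div_mul_eq_mul_div, div_mul_eq_mul_div,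
      div_le_iff₀ hk, lt_div_iff₀ hk]
    norm_cast
  ext m
  rw [hmem]
  simp only [Finset.mem_map, Finset.mem_filter, Finset.mem_univ, true_and, block_eq_iff,
    Fin.valEmbedding_apply]
  constructor
  · rintro ⟨i, hi, rfl⟩
    exact hi
  · intro h
    have hm : m < n := by
      have h1 := h.2.trans_le (Nat.mul_le_mul_right n a.2)
      rw [mul_comm k] at h1
      exact Nat.lt_of_mul_lt_mul_right h1
    exact ⟨⟨m, hm⟩, h, rfl⟩

lemma tendsto_card_block_div (a : Fin k) :
    Tendsto (fun n : ℕ => (Fintype.card {i // block k n i = a} : ℝ) / n) atTop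
      (𝓝 (Fintype.card (Fin k) : ℝ)⁻¹) := by
  have h := ((tendsto_nat_ceil_mul_div_atTop (R := ℝ) (a := (a + 1 : ℝ) / k) (by positivity)).sub
    (tendsto_nat_ceil_mul_div_atTop (R := ℝ) (a := (a : ℝ) / k) (by positivity))).comp
      tendsto_natCast_atTop_atTop
  rw [Fintype.card_fin, show (k : ℝ)⁻¹ = (a + 1 : ℝ) / k - a / k by ring]
  refine h.congr fun n => ?_
  rw [card_block, Nat.cast_sub (Nat.ceil_mono (by gcongr; linarith))]
  simp only [Function.comp]
  ring

lemma abs_sub_block_le {n : ℕ} (hn : k ≤ n) (i : Fin n) :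
    |((i : ℝ) + 1) / n - ((block k n i : ℝ) + 1) / k| ≤ 1 / k := by
  have hk : (0 : ℝ) < k := by exact_mod_cast NeZero.pos k
  have hkn : (k : ℝ) ≤ n := by exact_mod_cast hn
  have hn0 : (0 : ℝ) < n := hk.trans_le hkn
  obtain ⟨h1, h2⟩ := (block_eq_iff i (block k n i)).1 rfl
  have h1' : ((block k n i : ℕ) : ℝ) * n ≤ i * k := by exact_mod_cast h1
  have h2' : (i : ℝ) * k < ((block k n i : ℕ) + 1) * n := by exact_mod_cast h2
  rw [div_sub_div _ _ hn0.ne' hk.ne', abs_div, abs_of_pos (mul_pos hn0 hk),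
    div_le_div_iff₀ (mul_pos hn0 hk) hk]
  rw [show 1 * ((n : ℝ) * k) = n * k by ring]
  gcongr
  rw [abs_le]
  constructor <;> nlinarith

/-- Every continuous potential admits a value approximating both the variational problem and the
normalized log partition functions. -/
lemma exists_value_near {f : ℝ × ℝ → ℝ} (hf : ContinuousOn f unitSq) (θ : ℝ) {ε : ℝ}
    (hε : 0 < ε) :
    ∃ z : ℝ, (⨆ μ ∈ MM, objE f θ μ) ≤ ((z + ε : ℝ) : EReal) ∧
      ((z - ε : ℝ) : EReal) ≤ (⨆ μ ∈ MM, objE f θ μ) ∧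
      ∀ᶠ n : ℕ in atTop, |(Zn f θ n - Real.log (Nat.factorial n)) / n - z| ≤ 2 * ε := by
  have huc := isCompact_unitSq.uniformContinuousOn_of_continuous (hf.const_smul θ)
  obtain ⟨δ, hδ, huc⟩ := Metric.uniformContinuousOn_iff_le.1 huc ε hε
  obtain ⟨k', hk'⟩ := exists_nat_one_div_lt hδ
  set k := k' + 1 with hkdef
  have hk : (0 : ℝ) < k := by positivity
  have hkδ : 1 / (k : ℝ) ≤ δ := by rw [hkdef]; push_cast; exact hk'.le
  set F : ℝ × ℝ → ℝ := fun q => θ * f q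
  set g : Fin k → ℝ := fun a => ((a : ℝ) + 1) / k
  have hg : ∀ a, g a ∈ Set.Icc (0 : ℝ) 1 := fun a =>
    ⟨by positivity, by rw [div_le_one hk]; exact_mod_cast a.2⟩
  have hclose : ∀ x ∈ Set.Icc (0 : ℝ) 1, ∀ y ∈ Set.Icc (0 : ℝ) 1, ∀ a b,
      |x - g a| ≤ 1 / k → |y - g b| ≤ 1 / k → |θ * f (x, y) - θ * f (g a, g b)| ≤ ε := by
    intro x hx y hy a b hxa hyb
    exact huc (x, y) ⟨hx, hy⟩ (g a, g b) ⟨hg a, hg b⟩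
      (max_le (hxa.trans hkδ) (hyb.trans hkδ))
  set G : Fin k → Fin k → ℝ := fun a b => θ * f (g a, g b)
  obtain ⟨α, β, hds⟩ := exists_sinkhorn G
  obtain ⟨hu, hl⟩ := iSup_objE_near measurable_cell unif01_real_cell hds hf (θ := θ) (ε := ε)
    fun q hq => hclose q.1 hq.1 q.2 hq.2 _ _ (abs_sub_cell_le hq.1) (abs_sub_cell_le hq.2)
  refine ⟨blockValue α β, hu, hl, ?_⟩
  have hlim := tendsto_log_sum_exp_block (block k) tendsto_card_block_div hds
  filter_upwards [Metric.tendsto_nhds.1 hlim ε hε, eventually_ge_atTop k] with n hn hkn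
  have hn0 : (0 : ℝ) < n := hk.trans_le (by exact_mod_cast hkn)
  have hmem : ∀ i : Fin n, ((i : ℝ) + 1) / n ∈ Set.Icc (0 : ℝ) 1 := fun i =>
    ⟨by positivity, by rw [div_le_one hn0]; exact_mod_cast i.2⟩
  have hZ : |Zn f θ n - Real.log (∑ π : Equiv.Perm (Fin n),
      Real.exp (∑ i, G (block k n i) (block k n (π i))))| ≤ n * ε := by
    refine abs_log_sum_exp_sub_le fun π => ?_
    rw [permStat, Finset.mul_sum, ← Finset.sum_sub_distrib]
    refine (Finset.abs_sum_le_sum_abs _ _).trans ?_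
    refine (Finset.sum_le_sum fun i _ => hclose _ (hmem i) _ (hmem (π i)) _ _
      (abs_sub_block_le hkn i) (abs_sub_block_le hkn (π i))).trans_eq ?_
    simp
  rw [Real.dist_eq] at hn
  have h1 := abs_sub_le ((Zn f θ n - Real.log (Nat.factorial n)) / n)
    ((Real.log (∑ π : Equiv.Perm (Fin n), Real.exp (∑ i, G (block k n i) (block k n (π i)))) -
      Real.log n.factorial) / n) (blockValue α β)
  have h2 : |(Zn f θ n - Real.log (Nat.factorial n)) / n -
      (Real.log (∑ π : Equiv.Perm (Fin n), Real.exp (∑ i, G (block k n i) (block k n (π i)))) -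
        Real.log n.factorial) / n| ≤ ε := by
    rw [← sub_div, sub_sub_sub_cancel_right, abs_div, abs_of_pos hn0, div_le_iff₀ hn0, mul_comm ε]
    exact hZ
  linarith

end Grid

/-- For `f ∈ 𝓒` and `θ ∈ ℝ`, `(Z_n(f,θ) − log n!)/n` converges to
`Z(f,θ) = sup_{μ ∈ 𝓜} {θ μ[f] − D(μ‖u)}`. -/
theorem limit_log_partition (f : ℝ × ℝ → ℝ) (hf : memC f) (θ : ℝ) :
    ∃ Z : ℝ, (⨆ μ ∈ MM, objE f θ μ) = (Z : EReal) ∧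
      Tendsto (fun n : ℕ => (Zn f θ n - Real.log (Nat.factorial n)) / n) atTop (𝓝 Z) := by
  set s := ⨆ μ ∈ MM, objE f θ μ with hs
  obtain ⟨z₁, hu₁, hl₁, -⟩ := exists_value_near hf.1 θ one_pos
  have htop : s ≠ ⊤ := (hu₁.trans_lt (EReal.coe_lt_top _)).ne
  have hbot : s ≠ ⊥ := ((EReal.bot_lt_coe _).trans_le hl₁).ne'
  have hreal : s = (s.toReal : EReal) := (EReal.coe_toReal htop hbot).symm
  refine ⟨s.toReal, hreal, Metric.tendsto_nhds.2 fun ε hε => ?_⟩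
  obtain ⟨z, hu, hl, hev⟩ := exists_value_near hf.1 θ (show 0 < ε / 4 by positivity)
  rw [← hs, hreal, EReal.coe_le_coe_iff] at hu hl
  filter_upwards [hev] with n hn
  rw [Real.dist_eq, abs_lt]
  rw [abs_le] at hn
  constructor <;> linarith
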